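/- Let b > 0 and k ≥ 1 an integer. Define f(x) = Re((-i)^k) · h_b^{(k)}(x) + Re((-i)^{k+1}) · ℓ_b^{(k-1)}(x), where h_b(x) = b/(b^2+x^2) and ℓ_b(x) = (b^2-x^2)/(b^2+x^2)^2. Then the Fourier transform of f is f̂(y) = ((Re(i^k))^2 y^k + (Re(i^{k+1}))^2 y^{k-1}|y|) · (-1)^k 2^k π^{k+1} e^{-2πb|y|}. -/

import Mathlib

open Real Complex FourierTransform

section Aux
open MeasureTheory Set Filter Topology

/-- one-sided profile -/
noncomputable def eOne (b : ℝ) (y : ℝ) : ℂ := ((max y 0 * Real.exp (-(2 * π * b) * |y|) : ℝ) : ℂ)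

lemma eOne_eq (b y : ℝ) : eOne b y =
    (Ioi (0:ℝ)).indicator (fun y : ℝ => ((y * Real.exp (-(2 * π * b) * y) : ℝ) : ℂ)) y := by
  unfold eOne
  by_cases h : 0 < y
  · rw [indicator_of_mem (show y ∈ Ioi (0:ℝ) from h), max_eq_left h.le, abs_of_pos h]
  · rw [indicator_of_notMem (show y ∉ Ioi (0:ℝ) from h), max_eq_right (not_lt.1 h)]
    simp

lemma eOne_cont (b : ℝ) : Continuous (eOne b) := by
  unfold eOne
  fun_prop

lemma expInt (c : ℝ) (hc : 0 < c) :
    IntegrableOn (fun y : ℝ => y * Real.exp (-c * y)) (Ioi 0) := by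
  have := integrableOn_rpow_mul_exp_neg_mul_rpow (p := 1) (s := 1) (b := c) (by norm_num)
    (by norm_num) hc
  simpa using this

lemma eOne_int (b : ℝ) (hb : 0 < b) : Integrable (eOne b) := by
  rw [show eOne b = _ from funext (eOne_eq b), integrable_indicator_iff measurableSet_Ioi]
  exact (expInt (2 * π * b) (by positivity)).ofReal

lemma tendsto_aux (c : ℂ) (hc : 0 < c.re) :
    Tendsto (fun t : ℝ => (t : ℂ) * cexp (-c * t)) atTop (𝓝 0) := by
  rw [tendsto_zero_iff_norm_tendsto_zero]
  have := tendsto_rpow_mul_exp_neg_mul_atTop_nhds_zero 1 c.re hc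
  refine this.congr' ?_
  filter_upwards [eventually_gt_atTop 0] with t ht
  simp [Complex.norm_exp, abs_of_pos ht]

lemma tendsto_aux' (c : ℂ) (hc : 0 < c.re) :
    Tendsto (fun t : ℝ => cexp (-c * t)) atTop (𝓝 0) := by
  rw [tendsto_zero_iff_norm_tendsto_zero]
  have := tendsto_rpow_mul_exp_neg_mul_atTop_nhds_zero 0 c.re hc
  refine this.congr' ?_
  filter_upwards [eventually_gt_atTop 0] with t ht
  simp [Complex.norm_exp]

lemma integral_aux (c : ℂ) (hc : 0 < c.re) :
    ∫ t in Ioi (0:ℝ), (t : ℂ) * cexp (-c * t) = (c ^ 2)⁻¹ := by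
  have hc0 : c ≠ 0 := by rintro rfl; simp at hc
  have hd : ∀ t ∈ Ici (0:ℝ), HasDerivAt
      (fun t : ℝ => -(c⁻¹ * ((t : ℂ) * cexp (-c * t)) + (c ^ 2)⁻¹ * cexp (-c * t)))
      ((t : ℂ) * cexp (-c * t)) t := by
    intro t _
    have h1 : HasDerivAt (fun t : ℝ => (t : ℂ)) 1 t := Complex.ofRealCLM.hasDerivAt
    have h2 : HasDerivAt (fun t : ℝ => cexp (-c * t)) (cexp (-c * t) * (-c * 1)) t :=
      (h1.const_mul (-c)).cexp
    refine (((h1.fun_mul h2).const_mul c⁻¹).fun_add (h2.const_mul (c ^ 2)⁻¹)).fun_neg.congr_deriv ?_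
    field_simp
    ring
  have hi : IntegrableOn (fun t : ℝ => (t : ℂ) * cexp (-c * t)) (Ioi 0) := by
    refine (expInt c.re hc).mono' (by fun_prop) ?_
    filter_upwards [ae_restrict_mem measurableSet_Ioi] with t ht
    have ht : 0 < t := ht
    simp [Complex.norm_exp, abs_of_pos ht]
  have hl := (((tendsto_aux c hc).const_mul c⁻¹).add
    ((tendsto_aux' c hc).const_mul (c ^ 2)⁻¹)).neg
  rw [integral_Ioi_of_hasDerivAt_of_tendsto' hd hi hl]
  simp

lemma fourier_eOne (b : ℝ) (hb : 0 < b) (x : ℝ) :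
    𝓕 (eOne b) x = (4 * (π : ℂ) ^ 2)⁻¹ * (((b : ℂ) + I * x) ^ 2)⁻¹ := by
  rw [fourier_real_eq_integral_exp_smul]
  have : ∀ v : ℝ, cexp (↑(-2 * π * v * x) * I) • eOne b v =
      (Ioi (0:ℝ)).indicator (fun t : ℝ => (t : ℂ) * cexp (-(2 * π * (b + I * x)) * t)) v := by
    intro v
    rw [eOne_eq]
    by_cases h : v ∈ Ioi (0:ℝ)
    · rw [indicator_of_mem h, indicator_of_mem h]
      push_cast
      rw [smul_eq_mul, mul_left_comm, ← Complex.exp_add]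
      congr 2
      ring
    · rw [indicator_of_notMem h, indicator_of_notMem h, smul_zero]
  simp_rw [this]
  rw [integral_indicator measurableSet_Ioi, integral_aux, ← mul_inv]
  · congr 1; ring
  · simp; positivity

/-- `(x + i a)^{-2-n}` -/
noncomputable def wFun (a : ℝ) (n : ℕ) (x : ℝ) : ℂ := (((x : ℂ) + I * a) ^ (n + 2))⁻¹

lemma base_ne (a : ℝ) (ha : a ≠ 0) (x : ℝ) : (x : ℂ) + I * a ≠ 0 := by
  intro h
  have := congrArg Complex.im h
  simp at this
  exact ha this

lemma wFun_deriv (a : ℝ) (ha : a ≠ 0) (n : ℕ) (x : ℝ) :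
    HasDerivAt (wFun a n) (-(n + 2) * wFun a (n + 1) x) x := by
  have h1 : HasDerivAt (fun t : ℝ => (t : ℂ) + I * a) 1 x :=
    Complex.ofRealCLM.hasDerivAt.add_const _
  have h0 := base_ne a ha x
  refine ((h1.fun_pow (n + 2)).fun_inv (pow_ne_zero _ h0)).congr_deriv ?_
  unfold wFun
  field_simp
  push_cast
  ring

lemma wFun_contDiff (a : ℝ) (ha : a ≠ 0) (n : ℕ) {m : ℕ∞} : ContDiff ℝ m (wFun a n) := by
  unfold wFun
  refine ContDiff.inv ?_ (fun x => pow_ne_zero _ (base_ne a ha x))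
  exact (Complex.ofRealCLM.contDiff.add contDiff_const).pow _

lemma wFun_int (a : ℝ) (ha : a ≠ 0) (n : ℕ) : Integrable (wFun a n) := by
  have hI := (integrable_inv_one_add_sq.const_mul ((|a| ^ n)⁻¹ * (1 + (a^2)⁻¹)))
  refine hI.mono' (wFun_contDiff a ha n (m := 0)).continuous.aestronglyMeasurable ?_
  refine Eventually.of_forall fun x => ?_
  unfold wFun
  have hsq : ‖(x : ℂ) + I * a‖ ^ 2 = x ^ 2 + a ^ 2 := by
    rw [Complex.sq_norm, Complex.normSq_apply]; simp; ring
  have hlo : |a| ≤ ‖(x : ℂ) + I * a‖ := by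
    refine abs_le_of_sq_le_sq ?_ (norm_nonneg _)
    rw [hsq]; nlinarith
  have ha2 : 0 < a ^ 2 := by positivity
  have hpa : 0 < |a| := by positivity
  rw [norm_inv, norm_pow, pow_add, mul_inv, mul_assoc]
  gcongr
  rw [hsq, ← div_eq_mul_inv, inv_eq_one_div, div_le_div_iff₀ (by positivity) (by positivity)]
  have : (a^2)⁻¹ * a^2 = 1 := by field_simp
  have h3 : 0 ≤ (a^2)⁻¹ * x^2 := by positivity
  nlinarith

lemma wFun_iter (a : ℝ) (ha : a ≠ 0) (n : ℕ) :
    ∃ c : ℂ, iteratedDeriv n (wFun a 0) = fun x => c * wFun a n x := by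
  induction n with
  | zero => exact ⟨1, by simp⟩
  | succ n ih =>
    obtain ⟨c, hc⟩ := ih
    refine ⟨c * (-(n + 2)), ?_⟩
    rw [iteratedDeriv_succ, hc]
    ext x
    rw [((wFun_deriv a ha n x).const_mul c).deriv]
    ring

lemma wFun_iter_int (a : ℝ) (ha : a ≠ 0) (n : ℕ) :
    Integrable (iteratedDeriv n (wFun a 0)) := by
  obtain ⟨c, hc⟩ := wFun_iter a ha n
  rw [hc]
  exact (wFun_int a ha n).const_mul c

lemma eOne_fourier_fun (b : ℝ) (hb : 0 < b) :
    𝓕 (eOne b) = fun x => (-(4 * (π : ℂ) ^ 2)⁻¹) * wFun (-b) 0 x := by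
  ext x
  rw [fourier_eOne b hb, wFun, neg_mul, ← mul_neg, ← inv_neg]
  congr 2
  push_cast
  linear_combination ((x : ℂ) ^ 2 + b^2) * I_sq

lemma fourier_cmul (c : ℂ) (f : ℝ → ℂ) (y : ℝ) :
    𝓕 (fun x => c * f x) y = c * 𝓕 f y := by
  rw [fourier_real_eq_integral_exp_smul, fourier_real_eq_integral_exp_smul,
    ← integral_const_mul]
  congr 1; ext v; simp; ring

lemma fourier_add_fun (f g : ℝ → ℂ) (hf : Integrable f) (hg : Integrable g) (y : ℝ) :
    𝓕 (fun x => f x + g x) y = 𝓕 f y + 𝓕 g y := by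
  rw [fourier_eq, fourier_eq, fourier_eq, ← integral_add]
  · congr 1; ext v; simp [smul_add]
  · exact (Real.fourierIntegral_convergent_iff y).2 hf
  · exact (Real.fourierIntegral_convergent_iff y).2 hg

lemma fourier_wneg (b : ℝ) (hb : 0 < b) (y : ℝ) :
    𝓕 (wFun (-b) 0) y = -(4 * (π : ℂ) ^ 2) * eOne b (-y) := by
  have hint : Integrable (𝓕 (eOne b)) := by
    rw [eOne_fourier_fun b hb]
    exact (wFun_int _ (by linarith [hb] |> fun h : -b < 0 => h.ne) 0).const_mul _
  have h := congrFun ((eOne_cont b).fourierInv_fourier_eq (eOne_int b hb) hint) (-y)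
  rw [fourierInv_eq_fourier_neg, neg_neg, eOne_fourier_fun b hb, fourier_cmul] at h
  rw [← h]
  have : (π : ℂ) ≠ 0 := by exact_mod_cast pi_ne_zero
  field_simp

lemma fourier_wpos (b : ℝ) (hb : 0 < b) (y : ℝ) :
    𝓕 (wFun b 0) y = -(4 * (π : ℂ) ^ 2) * eOne b y := by
  have h1 : wFun b 0 = fun x => wFun (-b) 0 (-x) := by
    ext x
    simp only [wFun]
    push_cast
    congr 1
    ring
  have h2 := fourierInv_eq_fourier_comp_neg (wFun (-b) 0)
  rw [h1, ← h2, fourierInv_eq_fourier_neg, fourier_wneg b hb, neg_neg]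

/-- iterated derivatives commute with coercion -/
lemma iter_ofReal (f : ℝ → ℝ) (hf : ContDiff ℝ (⊤ : ℕ∞) f) (n : ℕ) :
    iteratedDeriv n (fun x => (f x : ℂ)) = fun x => ((iteratedDeriv n f x : ℝ) : ℂ) := by
  induction n with
  | zero => simp
  | succ n ih =>
    rw [iteratedDeriv_succ, ih]
    ext x
    have hd : DifferentiableAt ℝ (iteratedDeriv n f) x :=
      (hf.differentiable_iteratedDeriv n (by exact_mod_cast WithTop.coe_lt_top _)) x
    rw [iteratedDeriv_succ]
    exact hd.hasDerivAt.ofReal_comp.deriv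

/-- key: combination -/
lemma key (b : ℝ) (hb : 0 < b) (f : ℝ → ℝ) (hf : ContDiff ℝ (⊤ : ℕ∞) f) (p q : ℂ)
    (h : ∀ x, (f x : ℂ) = p * wFun b 0 x + q * wFun (-b) 0 x) (n : ℕ) (y : ℝ) :
    𝓕 (fun x => ((iteratedDeriv n f x : ℝ) : ℂ)) y =
      (2 * π * I * y) ^ n * (-(4 * (π : ℂ) ^ 2) * (p * eOne b y + q * eOne b (-y))) := by
  have hb0 : b ≠ 0 := hb.ne'
  have hb1 : -b ≠ 0 := neg_ne_zero.2 hb0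
  rw [← iter_ofReal f hf]
  have hfun : (fun x => (f x : ℂ)) = fun x => p * wFun b 0 x + q * wFun (-b) 0 x := funext h
  rw [hfun]
  have c1 : ContDiff ℝ (⊤ : ℕ∞) (fun x => p * wFun b 0 x) :=
    contDiff_const.mul (wFun_contDiff b hb0 0)
  have c2 : ContDiff ℝ (⊤ : ℕ∞) (fun x => q * wFun (-b) 0 x) :=
    contDiff_const.mul (wFun_contDiff (-b) hb1 0)
  have hint : ∀ m : ℕ, Integrable
      (iteratedDeriv m (fun x => p * wFun b 0 x + q * wFun (-b) 0 x)) := by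
    intro m
    have : iteratedDeriv m (fun x => p * wFun b 0 x + q * wFun (-b) 0 x) =
        fun x => p * iteratedDeriv m (wFun b 0) x + q * iteratedDeriv m (wFun (-b) 0) x := by
      ext x
      rw [iteratedDeriv_fun_add (c1.contDiffAt.of_le (by exact_mod_cast le_top))
        (c2.contDiffAt.of_le (by exact_mod_cast le_top)),
        iteratedDeriv_const_mul_field, iteratedDeriv_const_mul_field]
    rw [this]
    exact ((wFun_iter_int b hb0 m).const_mul p).add ((wFun_iter_int (-b) hb1 m).const_mul q)
  rw [fourier_iteratedDeriv (N := ⊤) (c1.add c2) (fun m _ => hint m) le_top]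
  simp only [smul_eq_mul]
  congr 1
  rw [fourier_add_fun _ _ ((wFun_int b hb0 0).const_mul p) ((wFun_int (-b) hb1 0).const_mul q),
    fourier_cmul, fourier_cmul, fourier_wpos b hb, fourier_wneg b hb]
  ring

lemma den_pos (b : ℝ) (hb : 0 < b) (x : ℝ) : 0 < b ^ 2 + x ^ 2 := by positivity

lemma fourier_l (b : ℝ) (hb : 0 < b) (n : ℕ) (y : ℝ) :
    𝓕 (fun x => ((iteratedDeriv n (fun x : ℝ => (b ^ 2 - x ^ 2) / (b ^ 2 + x ^ 2) ^ 2) x : ℝ) : ℂ)) y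
    = (2 * π * I * y) ^ n * (2 * (π : ℂ) ^ 2 * |y| * Real.exp (-2 * π * b * |y|)) := by
  rw [key b hb _ ?_ (-1/2) (-1/2) ?_ n y]
  · congr 1
    have : |y| = max y 0 + max (-y) 0 := by
      rcases le_total 0 y with h | h
      · simp [h, abs_of_nonneg]
      · simp [h, abs_of_nonpos]
    have h2 : ((|y| : ℝ) : ℂ) = (max y 0 : ℝ) + (max (-y) 0 : ℝ) := by rw [this]; push_cast; rfl
    unfold eOne
    rw [abs_neg, h2, ofReal_mul, ofReal_mul,
      show -2 * π * b * |y| = -(2 * π * b) * |y| by ring]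
    ring
  · exact ContDiff.div (by fun_prop) (by fun_prop) (fun x => (pow_pos (den_pos b hb x) 2).ne')
  · intro x
    have h1 := base_ne b hb.ne' x
    have h2 := base_ne (-b) (neg_ne_zero.2 hb.ne') x
    have hv : (x : ℂ) + I * ((-b : ℝ) : ℂ) = x - I * b := by push_cast; ring
    rw [hv] at h2
    have h3 : ((b : ℂ) ^ 2 + x ^ 2) = (x + I * b) * (x - I * b) := by
      linear_combination (b : ℂ) ^ 2 * I_sq
    unfold wFun
    rw [hv]
    push_cast
    rw [h3]
    have hu : (x : ℂ) + I * b - (x - I * b) = 2 * I * b := by ring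
    have hw : (x : ℂ) + I * b + (x - I * b) = 2 * x := by ring
    generalize (x : ℂ) + I * b = u at *
    generalize (x : ℂ) - I * b = v at *
    have hb' : (b : ℂ) = -I * (u - v) / 2 := by
      rw [hu]; linear_combination (b : ℂ) * I_sq
    have hx' : (x : ℂ) = (u + v) / 2 := by rw [hw]; ring
    rw [hb', hx']
    field_simp
    linear_combination ((u - v) ^ 2) * I_sq

lemma fourier_h (b : ℝ) (hb : 0 < b) (n : ℕ) (y : ℝ) :
    𝓕 (fun x => ((iteratedDeriv (n + 1) (fun x : ℝ => b / (b ^ 2 + x ^ 2)) x : ℝ) : ℂ)) y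
    = (2 * π * I * y) ^ (n + 1) * ((π : ℂ) * Real.exp (-2 * π * b * |y|)) := by
  have hd : deriv (fun x : ℝ => b / (b ^ 2 + x ^ 2)) =
      fun x => -(2 * b * x) / (b ^ 2 + x ^ 2) ^ 2 := by
    ext x
    have h1 : HasDerivAt (fun x : ℝ => b ^ 2 + x ^ 2) (2 * x) x := by
      simpa using (hasDerivAt_pow 2 x).const_add (b ^ 2)
    rw [((hasDerivAt_const x b).fun_div h1 (den_pos b hb x).ne').deriv]
    ring
  rw [iteratedDeriv_succ', hd]
  rw [key b hb _ ?_ (-I/2) (I/2) ?_ n y]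
  · rw [pow_succ (2 * π * I * y : ℂ) n, mul_assoc ((2 * π * I * y : ℂ) ^ n)]
    congr 1
    have : y = max y 0 - max (-y) 0 := by
      rcases le_total 0 y with h | h
      · simp [h]
      · simp [h]
    have h2 : (y : ℂ) = (max y 0 : ℝ) - (max (-y) 0 : ℝ) := by rw [← ofReal_sub, ← this]
    unfold eOne
    rw [abs_neg, ofReal_mul, ofReal_mul,
      show -2 * π * b * |y| = -(2 * π * b) * |y| by ring]
    linear_combination (-2 * π^2 * I * (Real.exp (-(2 * π * b) * |y|) : ℂ)) * h2
  · exact ContDiff.div (by fun_prop) (by fun_prop) (fun x => (pow_pos (den_pos b hb x) 2).ne')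
  · intro x
    have h1 := base_ne b hb.ne' x
    have h2 := base_ne (-b) (neg_ne_zero.2 hb.ne') x
    have hv : (x : ℂ) + I * ((-b : ℝ) : ℂ) = x - I * b := by push_cast; ring
    rw [hv] at h2
    have h3 : ((b : ℂ) ^ 2 + x ^ 2) = (x + I * b) * (x - I * b) := by
      linear_combination (b : ℂ) ^ 2 * I_sq
    unfold wFun
    rw [hv]
    push_cast
    rw [h3]
    have hu : (x : ℂ) + I * b - (x - I * b) = 2 * I * b := by ring
    have hw : (x : ℂ) + I * b + (x - I * b) = 2 * x := by ring
    generalize (x : ℂ) + I * b = u at *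
    generalize (x : ℂ) - I * b = v at *
    have hb' : (b : ℂ) = -I * (u - v) / 2 := by
      rw [hu]; linear_combination (b : ℂ) * I_sq
    have hx' : (x : ℂ) = (u + v) / 2 := by rw [hw]; ring
    rw [hb', hx']
    field_simp
    ring

end Aux

theorem fourier_f_k_sigma (b : ℝ) (hb : 0 < b) (k : ℕ) (hk : 1 ≤ k) (y : ℝ) :
    𝓕 (fun x : ℝ =>
        ((((-I) ^ k).re * iteratedDeriv k (fun x : ℝ => b / (b ^ 2 + x ^ 2)) x
          + ((-I) ^ (k + 1)).re *
            iteratedDeriv (k - 1) (fun x : ℝ => (b ^ 2 - x ^ 2) / (b ^ 2 + x ^ 2) ^ 2) x : ℝ) : ℂ)) y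
      = (((I ^ k).re ^ 2 * y ^ k + (I ^ (k + 1)).re ^ 2 * y ^ (k - 1) * |y| : ℝ) : ℂ)
          * (-1) ^ k * 2 ^ k * (π : ℂ) ^ (k + 1) * Real.exp (-2 * π * b * |y|) := by
  obtain ⟨n, rfl⟩ : ∃ n, k = n + 1 := ⟨k - 1, by omega⟩
  simp only [Nat.add_sub_cancel]
  have e1 : ∀ m : ℕ, (-I) ^ (2 * m) = (((-1) ^ m : ℝ) : ℂ) := by
    intro m; rw [pow_mul]; simp
  have e2 : ∀ m : ℕ, I ^ (2 * m) = (((-1) ^ m : ℝ) : ℂ) := by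
    intro m; rw [pow_mul]; simp
  have o1 : ∀ m : ℕ, ((-I) ^ (2 * m + 1)).re = 0 := by
    intro m; rw [pow_succ, e1, re_ofReal_mul]; simp
  have o2 : ∀ m : ℕ, (I ^ (2 * m + 1)).re = 0 := by
    intro m; rw [pow_succ, e2, re_ofReal_mul]; simp
  have s : ∀ m : ℕ, ((-1 : ℂ) ^ m) * (-1) ^ m = 1 := by
    intro m; rw [← mul_pow]; simp
  rcases Nat.even_or_odd' n with ⟨m, rfl | rfl⟩
  · rw [show 2 * m + 1 + 1 = 2 * (m + 1) by ring, o1, o2, e1, e2, ofReal_re]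
    simp only [zero_mul, zero_add, ofReal_mul]
    rw [fourier_cmul, fourier_l b hb]
    have := s m
    have hI : I ^ (2 * m) = (-1) ^ m := by rw [e2]; push_cast; rfl
    push_cast
    simp only [mul_pow, hI, pow_succ, pow_mul (-1 : ℂ) 2 m]
    norm_num
    generalize (-1 : ℂ) ^ m = t at *
    grind
  · rw [show 2 * m + 1 + 1 = 2 * (m + 1) by ring, o1, o2, e1, e2, ofReal_re]
    simp only [zero_mul, add_zero, ofReal_mul]
    rw [fourier_cmul, show 2 * (m + 1) = (2 * m + 1) + 1 by ring, fourier_h b hb]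
    have := s (m + 1)
    have hI : I ^ (2 * m + 1 + 1) = (-1) ^ (m + 1) := by
      rw [show 2 * m + 1 + 1 = 2 * (m + 1) by ring, e2]; push_cast; rfl
    have hs : (-1 : ℂ) ^ (2 * m + 1 + 1) = 1 := by
      rw [show 2 * m + 1 + 1 = 2 * (m + 1) by ring, pow_mul]; simp
    push_cast
    rw [mul_pow, mul_pow, mul_pow, hI, hs, pow_succ (π : ℂ) (2 * m + 1 + 1)]
    generalize (-1 : ℂ) ^ (m + 1) = t at *
    grind
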